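/- For every finite simple graph G = (V,E), E(G) ≤ 2·e₁₁ + Σ_{v ∈ V'} √(3·l(v) + d(v)). -/

import Mathlib

open Finset

namespace GraphEnergy

variable {V : Type*} [Fintype V] [DecidableEq V]

/-- The adjacency matrix of a simple graph over `ℝ` is Hermitian. -/
theorem adjMatrix_isHermitian (G : SimpleGraph V) [DecidableRel G.Adj] :
    (G.adjMatrix ℝ).IsHermitian := by
  ext i j
  simp [Matrix.conjTranspose_apply, SimpleGraph.adj_comm]

/-- The energy of a finite simple graph: the sum of the absolute values of the
eigenvalues of its adjacency matrix. -/
noncomputable def energy (G : SimpleGraph V) [DecidableRel G.Adj] : ℝ :=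
  ∑ i, |(adjMatrix_isHermitian G).eigenvalues i|

/-- The set of inner vertices: vertices of degree at least 2. -/
def innerVerts (G : SimpleGraph V) [DecidableRel G.Adj] : Finset V :=
  univ.filter (fun v => 2 ≤ G.degree v)

/-- The set of leaves: vertices of degree 1. -/
def leaves (G : SimpleGraph V) [DecidableRel G.Adj] : Finset V :=
  univ.filter (fun v => G.degree v = 1)

/-- The number of neighbors of `v` that are leaves. -/
def leafCount (G : SimpleGraph V) [DecidableRel G.Adj] (v : V) : ℕ :=
  ((G.neighborFinset v).filter (fun w => G.degree w = 1)).card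

open scoped Classical in
/-- The number of edges both of whose endpoints are leaves. -/
noncomputable def e11 (G : SimpleGraph V) [DecidableRel G.Adj] : ℕ :=
  (G.edgeFinset.filter (fun e => ∀ v ∈ e, G.degree v = 1)).card

/-- The absolute eigenvalue sum of a real symmetric matrix is attained by pairing it with a
symmetric matrix with unit rows. -/
theorem exists_sum_abs_eigenvalues_eq {A : Matrix V V ℝ} (hA : A.IsHermitian) :
    ∃ S : Matrix V V ℝ, (∀ v w, S w v = S v w) ∧ (∀ v, ∑ w, S v w ^ 2 = 1) ∧
      ∑ i, |hA.eigenvalues i| = ∑ v, ∑ w, A v w * S v w := by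
  set U : Matrix V V ℝ := hA.eigenvectorUnitary.1 with hU
  have hUU : star U * U = 1 := Unitary.coe_star_mul_self hA.eigenvectorUnitary
  have hUU' : U * star U = 1 := Unitary.coe_mul_star_self hA.eigenvectorUnitary
  have hspec : A = U * Matrix.diagonal hA.eigenvalues * star U := by
    have h := hA.spectral_theorem
    rw [Unitary.conjStarAlgAut_apply] at h
    simpa [Function.comp_def] using h
  set s : V → ℝ := fun i => if 0 ≤ hA.eigenvalues i then 1 else -1 with hs
  have hss : ∀ i, s i * s i = 1 := fun i => by simp only [hs]; split_ifs <;> norm_num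
  have hls : ∀ i, hA.eigenvalues i * s i = |hA.eigenvalues i| := fun i => by
    simp only [hs]
    split_ifs with h
    · rw [abs_of_nonneg h, mul_one]
    · rw [abs_of_neg (not_le.mp h), mul_neg_one]
  set S : Matrix V V ℝ := U * Matrix.diagonal s * star U with hS
  have hsymm : ∀ v w, S w v = S v w := by
    have h : S.transpose = S := by
      simp [hS, Matrix.star_eq_conjTranspose, Matrix.conjTranspose_eq_transpose_of_trivial,
        Matrix.transpose_mul, Matrix.mul_assoc]
    intro v w
    exact congrFun (congrFun h v) w
  have hconj : ∀ a b : V → ℝ, (U * Matrix.diagonal a * star U) * (U * Matrix.diagonal b * star U)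
      = U * Matrix.diagonal (fun i => a i * b i) * star U := fun a b => by
    calc _ = U * Matrix.diagonal a * (star U * U) * Matrix.diagonal b * star U := by
          simp only [Matrix.mul_assoc]
      _ = _ := by rw [hUU, Matrix.mul_one, Matrix.mul_assoc U, Matrix.diagonal_mul_diagonal]
  refine ⟨S, hsymm, fun v => ?_, ?_⟩
  · have h : S * S = 1 := by
      rw [hS, hconj]
      simp [hss, hUU']
    have hv := congrFun (congrFun h v) v
    rw [Matrix.mul_apply, Matrix.one_apply_eq] at hv
    rw [← hv]
    exact Finset.sum_congr rfl fun w _ => by rw [hsymm v w, sq]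
  · have h : (A * S).trace = ∑ i, |hA.eigenvalues i| := by
      conv_lhs => rw [hspec, hS, hconj, Matrix.trace_mul_comm, ← Matrix.mul_assoc, hUU,
        Matrix.one_mul, Matrix.trace_diagonal]
      exact Finset.sum_congr rfl fun i _ => hls i
    rw [← h, Matrix.trace]
    refine Finset.sum_congr rfl fun v _ => ?_
    rw [Matrix.diag_apply, Matrix.mul_apply]
    exact Finset.sum_congr rfl fun w _ => by rw [hsymm v w]

/-- Counting ordered pairs of adjacent leaves counts every leaf-leaf edge twice. -/
theorem sum_adj_leaves_eq (G : SimpleGraph V) [DecidableRel G.Adj] :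
    ∑ v, ∑ w, (if G.Adj v w ∧ G.degree v = 1 ∧ G.degree w = 1 then (1 : ℝ) else 0)
      = 2 * (e11 G : ℝ) := by
  classical
  let H : SimpleGraph V :=
    { Adj := fun v w => G.Adj v w ∧ G.degree v = 1 ∧ G.degree w = 1
      symm := ⟨fun _ _ h => ⟨h.1.symm, h.2.2, h.2.1⟩⟩
      loopless := ⟨fun _ h => G.irrefl h.1⟩ }
  have hcard : H.edgeFinset.card = e11 G := by
    unfold e11
    congr 1
    ext e
    induction e using Sym2.ind with
    | _ v w => simp [H]
  have hsum := H.sum_degrees_eq_twice_card_edges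
  rw [hcard] at hsum
  have hcast : ∑ v, (H.degree v : ℝ) = 2 * (e11 G : ℝ) := by exact_mod_cast hsum
  rw [← hcast]
  refine Finset.sum_congr rfl fun v _ => ?_
  rw [Finset.sum_boole, ← H.card_neighborFinset_eq_degree]
  congr 2
  ext w
  simp [H]

/-- Cauchy-Schwarz against a unit vector, with weight two on leaves. -/
theorem sum_weighted_neighbors_le (G : SimpleGraph V) [DecidableRel G.Adj] (v : V) (x : V → ℝ)
    (hx : ∑ w, x w ^ 2 = 1) :
    ∑ w ∈ G.neighborFinset v, (if G.degree w = 1 then 2 else 1) * x w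
      ≤ Real.sqrt (3 * (leafCount G v : ℝ) + (G.degree v : ℝ)) := by
  have hw : ∑ w ∈ G.neighborFinset v, (if G.degree w = 1 then (2 : ℝ) else 1) ^ 2
      = 3 * (leafCount G v : ℝ) + (G.degree v : ℝ) := by
    have h : ∀ w ∈ G.neighborFinset v, (if G.degree w = 1 then (2 : ℝ) else 1) ^ 2
        = 3 * (if G.degree w = 1 then 1 else 0) + 1 := fun w _ => by
      split_ifs <;> norm_num
    rw [Finset.sum_congr rfl h, Finset.sum_add_distrib, ← Finset.mul_sum, Finset.sum_boole]
    simp [leafCount]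
  have hx' : ∑ w ∈ G.neighborFinset v, x w ^ 2 ≤ 1 :=
    hx ▸ Finset.sum_le_univ_sum_of_nonneg fun w => sq_nonneg (x w)
  apply Real.le_sqrt_of_sq_le
  rw [← hw]
  refine (Finset.sum_mul_sq_le_sq_mul_sq _ _ _).trans ?_
  exact mul_le_of_le_one_right (Finset.sum_nonneg fun _ _ => sq_nonneg _) hx'

/-- Splitting a symmetric sum over adjacent pairs into leaf-leaf pairs and stars at inner
vertices. -/
theorem sum_adjMatrix_mul_eq (G : SimpleGraph V) [DecidableRel G.Adj] (S : Matrix V V ℝ)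
    (hS : ∀ v w, S w v = S v w) :
    ∑ v, ∑ w, G.adjMatrix ℝ v w * S v w
      = ∑ v, ∑ w, (if G.Adj v w ∧ G.degree v = 1 ∧ G.degree w = 1 then (1 : ℝ) else 0) * S v w
        + ∑ v ∈ innerVerts G,
          ∑ w ∈ G.neighborFinset v, (if G.degree w = 1 then 2 else 1) * S v w := by
  set P : V → V → ℝ := fun v w =>
    if G.Adj v w ∧ 2 ≤ G.degree v ∧ G.degree w = 1 then S v w else 0 with hP
  have hinner : ∑ v ∈ innerVerts G,
      ∑ w ∈ G.neighborFinset v, (if G.degree w = 1 then 2 else 1) * S v w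
      = ∑ v, ∑ w, (if G.Adj v w ∧ 2 ≤ G.degree v then
          (if G.degree w = 1 then 2 else 1) * S v w else 0) := by
    rw [innerVerts, Finset.sum_filter]
    refine Finset.sum_congr rfl fun v _ => ?_
    rw [SimpleGraph.neighborFinset_eq_filter, Finset.sum_filter]
    split_ifs with h <;> simp [h]
  have hsplit : ∀ v w, G.adjMatrix ℝ v w * S v w
      = (if G.Adj v w ∧ G.degree v = 1 ∧ G.degree w = 1 then (1 : ℝ) else 0) * S v w
        + (if G.Adj v w ∧ 2 ≤ G.degree v then (if G.degree w = 1 then 2 else 1) * S v w else 0)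
        + (P w v - P v w) := by
    intro v w
    by_cases h : G.Adj v w
    · have hv : 0 < G.degree v := (G.degree_pos_iff_exists_adj v).2 ⟨w, h⟩
      have hw : 0 < G.degree w := (G.degree_pos_iff_exists_adj w).2 ⟨v, h.symm⟩
      have hv' : G.degree v = 1 ∨ 2 ≤ G.degree v := by lia
      have hw' : G.degree w = 1 ∨ 2 ≤ G.degree w := by lia
      simp only [hP, SimpleGraph.adjMatrix_apply, h, h.symm, hS v w]
      rcases hv' with a | a <;> rcases hw' with b | b
      · simp [a, b]
      · simp [a, b, show G.degree w ≠ 1 by lia]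
      · simp [a, b, show G.degree v ≠ 1 by lia]
        ring
      · simp [a, b, show G.degree v ≠ 1 by lia, show G.degree w ≠ 1 by lia]
    · simp [hP, h, G.adj_comm w v]
  have hcancel : ∑ v, ∑ w, (P w v - P v w) = 0 := by
    simp only [Finset.sum_sub_distrib]
    rw [Finset.sum_comm, sub_self]
  rw [hinner]
  simp only [hsplit, Finset.sum_add_distrib, hcancel, add_zero]

/-- For every graph `G`, `E(G) ≤ 2 e₁₁ + ∑_{v ∈ V'} √(3 l(v) + d(v))`. -/
theorem energy_le_e11_add_sum_inner_sqrt (G : SimpleGraph V) [DecidableRel G.Adj] :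
    energy G ≤ 2 * (e11 G : ℝ) + ∑ v ∈ innerVerts G,
      Real.sqrt (3 * (leafCount G v : ℝ) + (G.degree v : ℝ)) := by
  obtain ⟨S, hsymm, hrow, hS⟩ := exists_sum_abs_eigenvalues_eq (adjMatrix_isHermitian G)
  have hle : ∀ v w, S v w ≤ 1 := fun v w => by
    have h : S v w ^ 2 ≤ 1 := hrow v ▸
      Finset.single_le_sum (f := fun w => S v w ^ 2) (fun _ _ => sq_nonneg _) (Finset.mem_univ w)
    nlinarith
  rw [energy, hS, sum_adjMatrix_mul_eq G S hsymm, ← sum_adj_leaves_eq G]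
  refine add_le_add (Finset.sum_le_sum fun v _ => Finset.sum_le_sum fun w _ => ?_)
    (Finset.sum_le_sum fun v _ => sum_weighted_neighbors_le G v (S v) (hrow v))
  exact mul_le_of_le_one_right (by split_ifs <;> norm_num) (hle v w)

end GraphEnergy
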